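/- If π : Γ → Δ is a tropical admissible cover, then for every divisor D ∈ Div(Δ) one has rk(π*D) ≥ rk(D). -/

import Mathlib

open scoped Classical

noncomputable section

/-! ## Combinatorial models of metric graphs and their topological realizations -/

/-- A combinatorial model of a metric graph: a finite multigraph with positive
edge lengths. -/
structure CombGraph : Type 1 where
  V : Type
  E : Type
  fintypeV : Fintype V
  fintypeE : Fintype E
  src : E → V
  tgt : E → V
  len : E → ℝ
  len_pos : ∀ e, 0 < len e

attribute [instance] CombGraph.fintypeV CombGraph.fintypeE

namespace CombGraph

variable (G : CombGraph)

instance : TopologicalSpace G.V := ⊥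
instance : TopologicalSpace G.E := ⊥

/-- The disjoint union of the vertices and of the edges seen as real intervals,
before gluing. -/
def Pre : Type := G.V ⊕ (G.E × ℝ)

instance : TopologicalSpace G.Pre := inferInstanceAs (TopologicalSpace (G.V ⊕ (G.E × ℝ)))

/-- The predicate selecting legitimate points: a point of an edge `e` must have its
coordinate in `[0, len e]`. -/
def Ok : G.Pre → Prop
  | Sum.inl _ => True
  | Sum.inr p => 0 ≤ p.2 ∧ p.2 ≤ G.len p.1

/-- Points of the model before gluing. -/
def PreR : Type := {p : G.Pre // G.Ok p}

instance : TopologicalSpace G.PreR := inferInstanceAs (TopologicalSpace {p : G.Pre // G.Ok p})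

/-- The gluing relation: the endpoints of each edge are glued to the corresponding
vertices. -/
inductive Glue : G.PreR → G.PreR → Prop
  | srcGlue (e : G.E) :
      Glue ⟨Sum.inl (G.src e), trivial⟩ ⟨Sum.inr (e, 0), ⟨le_refl 0, (G.len_pos e).le⟩⟩
  | tgtGlue (e : G.E) :
      Glue ⟨Sum.inl (G.tgt e), trivial⟩ ⟨Sum.inr (e, G.len e), ⟨(G.len_pos e).le, le_refl _⟩⟩

/-- The topological realization of the combinatorial model: the underlying
topological space of the associated metric graph. -/
def Space : Type := Quot G.Glue

instance : TopologicalSpace G.Space := inferInstanceAs (TopologicalSpace (Quot G.Glue))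

/-- The point of the realization corresponding to a vertex. -/
def vertexPt (v : G.V) : G.Space := Quot.mk _ ⟨Sum.inl v, trivial⟩

/-- Clamping of a real coordinate into `[0, len e]`. -/
def clamp (e : G.E) (t : ℝ) : ℝ := max 0 (min t (G.len e))

/-- The point of the realization lying on the edge `e` at coordinate `t`
(the coordinate is clamped into `[0, len e]`). -/
def edgePt (e : G.E) (t : ℝ) : G.Space :=
  Quot.mk _ ⟨Sum.inr (e, G.clamp e t),
    ⟨le_max_left 0 _, max_le (G.len_pos e).le (min_le_right _ _)⟩⟩

/-- The genus (first Betti number) of the (connected) metric graph. -/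
def genus : ℤ := (Fintype.card G.E : ℤ) - (Fintype.card G.V : ℤ) + 1

/-! ### Outgoing directions, valence -/

/-- `d = (e, b)` is an outgoing unit tangent direction at the point `x`:
if `b = true` it points in the direction of increasing coordinate on `e`, if
`b = false` in the direction of decreasing coordinate. -/
def IsDir (x : G.Space) (d : G.E × Bool) : Prop :=
  if d.2 then ∃ t, 0 ≤ t ∧ t < G.len d.1 ∧ x = G.edgePt d.1 t
  else ∃ t, 0 < t ∧ t ≤ G.len d.1 ∧ x = G.edgePt d.1 t

/-- The (finite) set of outgoing directions at a point. -/
def dirSet (x : G.Space) : Finset (G.E × Bool) :=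
  Finset.univ.filter fun d => G.IsDir x d

/-- The valence of a point of the realization: the number of outgoing
directions at that point. -/
def valence (x : G.Space) : ℕ := (G.dirSet x).card

/-- The coordinate on the edge `d.1` of a point `x` admitting `d` as an outgoing
direction. -/
def dirCoord (x : G.Space) (d : G.E × Bool) : ℝ :=
  if d.2 then
    (if h : ∃ t, 0 ≤ t ∧ t < G.len d.1 ∧ x = G.edgePt d.1 t then h.choose else 0)
  else
    (if h : ∃ t, 0 < t ∧ t ≤ G.len d.1 ∧ x = G.edgePt d.1 t then h.choose else 0)

/-- The point at distance `u` from `x` in the outgoing direction `d`. -/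
def dirPt (x : G.Space) (d : G.E × Bool) (u : ℝ) : G.Space :=
  G.edgePt d.1 (G.dirCoord x d + (if d.2 then u else -u))

end CombGraph

/-! ### Rational functions and divisors -/

/-- A function `g : [0, L] → ℝ` is piecewise integral affine if there is a finite
subdivision of `[0, L]` on whose pieces `g` is affine with integral slope. -/
def PWIntAffine (g : ℝ → ℝ) (L : ℝ) : Prop :=
  ∃ (n : ℕ) (t : ℕ → ℝ) (m : ℕ → ℤ) (b : ℕ → ℝ),
    t 0 = 0 ∧ t n = L ∧ (∀ i, i < n → t i < t (i + 1)) ∧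
    (∀ i, i < n → ∀ u, t i ≤ u → u ≤ t (i + 1) → g u = (m i : ℝ) * u + b i)

/-- A rational function on the metric graph realizing `G`: a continuous function
which is piecewise integral affine on every edge. -/
structure RatFn (G : CombGraph) where
  toFun : G.Space → ℝ
  continuous : Continuous toFun
  piecewise : ∀ e : G.E, PWIntAffine (fun t => toFun (G.edgePt e t)) (G.len e)

namespace CombGraph

variable (G : CombGraph)

/-- The right-hand slope of a rational function on the edge `e` at coordinate `t`. -/
def rightSlope (f : RatFn G) (e : G.E) (t : ℝ) : ℝ :=
  derivWithin (fun u => f.toFun (G.edgePt e u)) (Set.Ici t) t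

/-- The left-hand slope of a rational function on the edge `e` at coordinate `t`. -/
def leftSlope (f : RatFn G) (e : G.E) (t : ℝ) : ℝ :=
  derivWithin (fun u => f.toFun (G.edgePt e u)) (Set.Iic t) t

/-- The order of a rational function at a point: the sum of its outgoing slopes. -/
def ordAt (f : RatFn G) (x : G.Space) : ℝ :=
  if h : ∃ v : G.V, x = G.vertexPt v then
    ∑ e : G.E,
      ((if G.src e = h.choose then G.rightSlope f e 0 else 0)
        + (if G.tgt e = h.choose then -(G.leftSlope f e (G.len e)) else 0))
  else if h2 : ∃ p : G.E × ℝ, 0 < p.2 ∧ p.2 < G.len p.1 ∧ x = G.edgePt p.1 p.2 then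
    G.rightSlope f h2.choose.1 h2.choose.2 - G.leftSlope f h2.choose.1 h2.choose.2
  else 0

/-- The group of divisors of the metric graph: the free abelian group on the
points of the realization. -/
abbrev Div (G : CombGraph) : Type := G.Space →₀ ℤ

/-- The degree of a divisor. -/
def degDiv (D : Div G) : ℤ := D.sum fun _ n => n

/-- A divisor is effective if all of its coefficients are nonnegative. -/
def Effective (D : Div G) : Prop := ∀ x, 0 ≤ D x

/-- `D` is the principal divisor associated to the rational function `f`. -/
def IsPrincipal (D : Div G) (f : RatFn G) : Prop := ∀ x, (D x : ℝ) = G.ordAt f x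

/-- Two divisors are linearly equivalent if their difference is principal. -/
def LinEquiv (D D' : Div G) : Prop := ∃ f : RatFn G, G.IsPrincipal (D - D') f

/-- The Baker–Norine rank of a divisor: the largest integer `k` such that for every
effective divisor `E` of degree `k` the linear system `|D - E|` is nonempty.  (For
negative `k` the condition is vacuous, so the supremum is `-1` exactly when
`|D|` is empty.) -/
def Rk (D : Div G) : ℤ :=
  sSup {k : ℤ | ∀ E : Div G, G.Effective E → G.degDiv E = k →
    ∃ E' : Div G, G.Effective E' ∧ G.LinEquiv (D - E) E'}

/-- A point of a metric graph is a Weierstrass point if `rk(g·[x]) ≥ 1`. -/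
def IsWeierstrass (x : G.Space) : Prop :=
  1 ≤ G.Rk (G.genus • Finsupp.single x 1)

/-- The canonical divisor of a metric graph. -/
def canonical : Div G :=
  ∑ v : G.V, ((G.valence (G.vertexPt v) : ℤ) - 2) • Finsupp.single (G.vertexPt v) 1

end CombGraph
/-! ### Tropical admissible covers -/

/-- A tropical admissible cover between the metric graphs realizing `G` and `D`:
a continuous surjective map with finite fibers which is locally integral affine
(witnessed by the data of the image direction `dirMap` and the absolute value
`slope` of the integral slope along every outgoing direction), such that the
local degree is well defined at every point, and all Riemann–Hurwitz numbers are
nonnegative. -/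
structure TropCover (G D : CombGraph) where
  toFun : G.Space → D.Space
  continuous : Continuous toFun
  surjective : Function.Surjective toFun
  finiteFibers : ∀ y : D.Space, (toFun ⁻¹' {y}).Finite
  dirMap : G.Space → G.E × Bool → D.E × Bool
  slope : G.Space → G.E × Bool → ℕ
  localDeg : G.Space → ℕ
  dirMap_isDir : ∀ x d, G.IsDir x d → D.IsDir (toFun x) (dirMap x d)
  locAffine : ∀ x d, G.IsDir x d → ∃ ε > (0 : ℝ), ∀ u, 0 ≤ u → u ≤ ε →
      toFun (G.dirPt x d u) = D.dirPt (toFun x) (dirMap x d) ((slope x d : ℝ) * u)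
  localDeg_spec : ∀ x d', D.IsDir (toFun x) d' →
      localDeg x = ∑ d ∈ (G.dirSet x).filter (fun d => dirMap x d = d'), slope x d
  rh_nonneg : ∀ x, 0 ≤ (G.valence x : ℤ) - 2 - (localDeg x : ℤ) * ((D.valence (toFun x) : ℤ) - 2)

namespace TropCover

variable {G D : CombGraph} (π : TropCover G D)

/-- The fiber of a point as a finite set. -/
def fiber (y : D.Space) : Finset G.Space := (π.finiteFibers y).toFinset

/-- The pullback `π*[y]` of the divisor `[y]`. -/
def fiberDiv (y : D.Space) : CombGraph.Div G :=
  ∑ z ∈ π.fiber y, (π.localDeg z : ℤ) • Finsupp.single z 1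

/-- The pullback morphism on divisors. -/
def pullback (A : CombGraph.Div D) : CombGraph.Div G :=
  A.sum fun y n => n • π.fiberDiv y

/-- The pushforward morphism on divisors. -/
def pushforward (A : CombGraph.Div G) : CombGraph.Div D :=
  Finsupp.mapDomain π.toFun A

/-- The degree of the cover, computed at the point `y` of the target. -/
def degAt (y : D.Space) : ℕ := ∑ z ∈ π.fiber y, π.localDeg z

/-- The Riemann–Hurwitz number of the cover at a point of the source. -/
def rhNum (x : G.Space) : ℤ :=
  (G.valence x : ℤ) - 2 - (π.localDeg x : ℤ) * ((D.valence (π.toFun x) : ℤ) - 2)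

/-- The (finite) set of points where the ramification divisor may be supported:
the vertices of the source together with the fibers of the vertices of the target
(at every other point the Riemann–Hurwitz number vanishes). -/
def ramSupport : Finset G.Space :=
  Finset.univ.image G.vertexPt ∪
    Finset.univ.biUnion fun v : D.V => π.fiber (D.vertexPt v)

/-- The ramification divisor `R_π = Σ_x r_π(x)·[x]` of the cover. -/
def ramDiv : CombGraph.Div G :=
  ∑ x ∈ π.ramSupport, π.rhNum x • Finsupp.single x 1

end TropCover

/-! ### Piecewise integral affine functions on an interval -/

/-- On a short interval to the right of `t`, the function `F` is affine with slope `s`. -/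
def HasRightSlope (F : ℝ → ℝ) (t s : ℝ) : Prop :=
  ∃ ε > (0 : ℝ), ∀ u, 0 ≤ u → u ≤ ε → F (t + u) = F t + s * u

theorem HasRightSlope.derivWithin_eq {F : ℝ → ℝ} {t s : ℝ} (h : HasRightSlope F t s) :
    derivWithin F (Set.Ici t) t = s := by
  obtain ⟨ε, hε, h⟩ := h
  have h1 : HasDerivAt (fun v => F t + s * (v - t)) s t := by
    simpa using (((hasDerivAt_id t).sub_const t).const_mul s).const_add (F t)
  have h2 : HasDerivWithinAt F s (Set.Ici t) t := by
    refine h1.hasDerivWithinAt.congr_of_eventuallyEq ?_ (by simp)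
    filter_upwards [self_mem_nhdsWithin,
      mem_nhdsWithin_of_mem_nhds (Iio_mem_nhds (lt_add_of_pos_right t hε))] with v hv hv'
    have hv : t ≤ v := hv
    have hv' : v < t + ε := hv'
    have := h (v - t) (by linarith) (by linarith)
    simpa using this
  exact h2.derivWithin (uniqueDiffOn_Ici t t Set.self_mem_Ici)

theorem HasRightSlope.derivWithin_reflect {F : ℝ → ℝ} {t s : ℝ}
    (h : HasRightSlope (fun v => F (-v)) (-t) s) :
    derivWithin F (Set.Iic t) t = -s := by
  obtain ⟨ε, hε, h⟩ := h
  have h1 : HasDerivAt (fun v => F t + s * (t - v)) (-s) t := by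
    simpa using (((hasDerivAt_id t).const_sub t).const_mul s).const_add (F t)
  have h2 : HasDerivWithinAt F (-s) (Set.Iic t) t := by
    refine h1.hasDerivWithinAt.congr_of_eventuallyEq ?_ (by simp)
    filter_upwards [self_mem_nhdsWithin,
      mem_nhdsWithin_of_mem_nhds (Ioi_mem_nhds (sub_lt_self t hε))] with v hv hv'
    have hv : v ≤ t := hv
    have hv' : t - ε < v := hv'
    have := h (t - v) (by linarith) (by linarith)
    simpa using this
  exact h2.derivWithin (uniqueDiffOn_Iic t t Set.self_mem_Iic)

/-- A piecewise affine function stays so when prolonged by one affine piece. -/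
theorem PWIntAffine.extend {g : ℝ → ℝ} {a c : ℝ} (h : PWIntAffine g a) (hac : a < c)
    {k : ℤ} {r : ℝ} (hg : ∀ u, a ≤ u → u ≤ c → g u = k * u + r) : PWIntAffine g c := by
  obtain ⟨n, t, m, b, h0, hn, hlt, haff⟩ := h
  refine ⟨n + 1, fun i => if i ≤ n then t i else c, fun i => if i < n then m i else k,
    fun i => if i < n then b i else r, by simpa using h0, by simp, fun i hi => ?_,
    fun i hi u => ?_⟩
  · rcases Nat.lt_succ_iff_lt_or_eq.1 hi with hi | rfl
    · simpa [hi.le, Nat.succ_le_of_lt hi] using hlt i hi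
    · simpa [hn] using hac
  · rcases Nat.lt_succ_iff_lt_or_eq.1 hi with hi | rfl
    · simpa [hi, hi.le, Nat.succ_le_of_lt hi] using haff i hi u
    · simpa [hn] using hg u

/-- By compactness, a function all of whose germs are integral affine is piecewise
integral affine. -/
theorem PWIntAffine.of_germs {g : ℝ → ℝ} {L : ℝ} (hL : 0 ≤ L)
    (hr : ∀ t, 0 ≤ t → t < L → ∃ k : ℤ, HasRightSlope g t k)
    (hl : ∀ t, 0 < t → t ≤ L → ∃ k : ℤ, HasRightSlope (fun v => g (-v)) (-t) k) :
    PWIntAffine g L := by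
  set S : Set ℝ := {c | 0 ≤ c ∧ c ≤ L ∧ PWIntAffine g c} with hS
  have h0 : (0 : ℝ) ∈ S :=
    ⟨le_rfl, hL, 0, fun _ => 0, fun _ => 0, fun _ => 0, rfl, rfl, by simp, by simp⟩
  have hbdd : BddAbove S := ⟨L, fun c hc => hc.2.1⟩
  have hc0 : 0 ≤ sSup S := le_csSup hbdd h0
  have hcL : sSup S ≤ L := csSup_le ⟨0, h0⟩ fun c hc => hc.2.1
  have hmem : sSup S ∈ S := by
    rcases hc0.eq_or_lt with h | hpos
    · rwa [← h]
    obtain ⟨k, ε, hε, hk⟩ := hl _ hpos hcL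
    obtain ⟨a, ha, hlt⟩ := exists_lt_of_lt_csSup ⟨0, h0⟩ (sub_lt_self (sSup S) hε)
    rcases (le_csSup hbdd ha).eq_or_lt with h | hac
    · rwa [← h]
    refine ⟨hc0, hcL, ha.2.2.extend hac (k := -k) (r := g (sSup S) + k * sSup S) ?_⟩
    intro u hu hu'
    have := hk (sSup S - u) (by linarith) (by linarith)
    simp only [neg_add_rev, neg_sub, neg_neg] at this
    rw [show u - sSup S + sSup S = u by ring] at this
    rw [this]; push_cast; ring
  rcases hcL.eq_or_lt with h | hlt
  · rw [← h]; exact hmem.2.2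
  obtain ⟨k, ε, hε, hk⟩ := hr _ hc0 hlt
  have hd : sSup S < min (sSup S + ε) L := lt_min (by linarith) hlt
  have : min (sSup S + ε) L ∈ S := by
    refine ⟨hc0.trans hd.le, min_le_right _ _,
      hmem.2.2.extend hd (k := k) (r := g (sSup S) - k * sSup S) fun u hu hu' => ?_⟩
    have := hk (u - sSup S) (by linarith) (by linarith [hu'.trans (min_le_left _ _)])
    rw [add_sub_cancel] at this
    rw [this]; ring
  exact absurd (le_csSup hbdd this) (not_le.2 hd)

theorem hasRightSlope_of_affine {g : ℝ → ℝ} {a c k r t : ℝ}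
    (hg : ∀ u, a ≤ u → u ≤ c → g u = k * u + r) (ht : a ≤ t) (htc : t < c) :
    HasRightSlope g t k := by
  refine ⟨c - t, by linarith, fun u hu hu' => ?_⟩
  rw [hg _ (by linarith) (by linarith), hg t ht htc.le]; ring

theorem hasRightSlope_reflect_of_affine {g : ℝ → ℝ} {a c k r t : ℝ}
    (hg : ∀ u, a ≤ u → u ≤ c → g u = k * u + r) (ht : a < t) (htc : t ≤ c) :
    HasRightSlope (fun v => g (-v)) (-t) (-k) := by
  refine ⟨t - a, by linarith, fun u hu hu' => ?_⟩
  simp only [neg_add_rev, neg_neg]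
  rw [hg _ (by linarith) (by linarith), hg t ht.le htc]; ring

theorem sum_indicator_Ico {t : ℕ → ℝ} {n : ℕ} (hlt : ∀ i, i < n → t i < t (i + 1)) {s : ℝ}
    (h0 : t 0 ≤ s) (hn : s < t n) :
    ∑ i ∈ Finset.range n, (if t i ≤ s ∧ s < t (i + 1) then (1 : ℝ) else 0) = 1 := by
  have := Finset.sum_range_sub' (fun i => if t i ≤ s then (1 : ℝ) else 0) n
  simp only [h0, not_le.2 hn, if_true, if_false, sub_zero] at this
  rw [← this]
  refine Finset.sum_congr rfl fun i hi => ?_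
  have := hlt i (Finset.mem_range.1 hi)
  grind

theorem sum_indicator_Ioc {t : ℕ → ℝ} {n : ℕ} (hlt : ∀ i, i < n → t i < t (i + 1)) {s : ℝ}
    (h0 : t 0 < s) (hn : s ≤ t n) :
    ∑ i ∈ Finset.range n, (if t i < s ∧ s ≤ t (i + 1) then (1 : ℝ) else 0) = 1 := by
  have := Finset.sum_range_sub' (fun i => if t i < s then (1 : ℝ) else 0) n
  simp only [h0, not_lt.2 hn, if_true, if_false, sub_zero] at this
  rw [← this]
  refine Finset.sum_congr rfl fun i hi => ?_
  have := hlt i (Finset.mem_range.1 hi)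
  grind

theorem PWIntAffine.exists_right {g : ℝ → ℝ} {L s : ℝ} (h : PWIntAffine g L) (h0 : 0 ≤ s)
    (hL : s < L) : ∃ k : ℤ, HasRightSlope g s k := by
  obtain ⟨n, t, m, b, ht0, htn, hlt, haff⟩ := h
  have := sum_indicator_Ico hlt (ht0.trans_le h0) (hL.trans_eq htn.symm)
  obtain ⟨i, hi, hne⟩ := Finset.exists_ne_zero_of_sum_ne_zero (this.trans_ne one_ne_zero)
  rw [ne_eq, ite_eq_right_iff, Classical.not_imp] at hne
  exact ⟨m i, hasRightSlope_of_affine (haff i (Finset.mem_range.1 hi)) hne.1.1 hne.1.2⟩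

theorem PWIntAffine.exists_left {g : ℝ → ℝ} {L s : ℝ} (h : PWIntAffine g L) (h0 : 0 < s)
    (hL : s ≤ L) : ∃ k : ℤ, HasRightSlope (fun v => g (-v)) (-s) k := by
  obtain ⟨n, t, m, b, ht0, htn, hlt, haff⟩ := h
  have := sum_indicator_Ioc hlt (ht0.trans_lt h0) (hL.trans_eq htn.symm)
  obtain ⟨i, hi, hne⟩ := Finset.exists_ne_zero_of_sum_ne_zero (this.trans_ne one_ne_zero)
  rw [ne_eq, ite_eq_right_iff, Classical.not_imp] at hne
  refine ⟨-m i, ?_⟩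
  push_cast
  exact hasRightSlope_reflect_of_affine (haff i (Finset.mem_range.1 hi)) hne.1.1 hne.1.2

/-- The change of slope of a piecewise affine function at `s`, in terms of its pieces. -/
theorem sum_pieces_eq_slope_sub {g : ℝ → ℝ} {L : ℝ} {n : ℕ} {t : ℕ → ℝ} {m : ℕ → ℤ} {b : ℕ → ℝ}
    (ht0 : t 0 = 0) (htn : t n = L) (hlt : ∀ i, i < n → t i < t (i + 1))
    (haff : ∀ i, i < n → ∀ u, t i ≤ u → u ≤ t (i + 1) → g u = (m i : ℝ) * u + b i)
    {s : ℝ} (h0 : 0 ≤ s) (hL : s ≤ L) :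
    ∑ i ∈ Finset.range n, (m i : ℝ) * ((if t i = s then 1 else 0) - if t (i + 1) = s then 1 else 0)
      = (if s < L then derivWithin g (Set.Ici s) s else 0)
        - (if 0 < s then derivWithin g (Set.Iic s) s else 0) := by
  have hmono : ∀ i, i ≤ n → 0 ≤ t i := by
    intro i
    induction i with
    | zero => intro; exact ht0.ge
    | succ i ih => intro hi; exact (ih (by omega)).trans (hlt i (by omega)).le
  have hmono' : ∀ j, j ≤ n → t (n - j) ≤ L := by
    intro j
    induction j with
    | zero => intro; exact htn.le
    | succ j ih =>
      intro hj
      have := hlt (n - (j + 1)) (by omega)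
      rw [show n - (j + 1) + 1 = n - j by omega] at this
      exact this.le.trans (ih (by omega))
  have hA : (if s < L then derivWithin g (Set.Ici s) s else 0)
      = ∑ i ∈ Finset.range n, (m i : ℝ) * (if t i ≤ s ∧ s < t (i + 1) then 1 else 0) := by
    split_ifs with h
    · refine (mul_one _).symm.trans ((congrArg _ (sum_indicator_Ico hlt (ht0.trans_le h0)
        (h.trans_eq htn.symm)).symm).trans ?_)
      rw [Finset.mul_sum]
      refine Finset.sum_congr rfl fun i hi => ?_
      split_ifs with hi'
      · rw [(hasRightSlope_of_affine (haff i (Finset.mem_range.1 hi)) hi'.1 hi'.2).derivWithin_eq]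
      · simp
    · refine (Finset.sum_eq_zero fun i hi => ?_).symm
      have hin := Finset.mem_range.1 hi
      have := hmono' (n - (i + 1)) (by omega)
      rw [show n - (n - (i + 1)) = i + 1 by omega] at this
      rw [if_neg (by rintro ⟨_, h'⟩; linarith), mul_zero]
  have hB : (if 0 < s then derivWithin g (Set.Iic s) s else 0)
      = ∑ i ∈ Finset.range n, (m i : ℝ) * (if t i < s ∧ s ≤ t (i + 1) then 1 else 0) := by
    split_ifs with h
    · refine (mul_one _).symm.trans ((congrArg _ (sum_indicator_Ioc hlt (ht0.trans_lt h)
        (hL.trans_eq htn.symm)).symm).trans ?_)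
      rw [Finset.mul_sum]
      refine Finset.sum_congr rfl fun i hi => ?_
      split_ifs with hi'
      · rw [(hasRightSlope_reflect_of_affine (haff i (Finset.mem_range.1 hi)) hi'.1
          hi'.2).derivWithin_reflect, neg_neg]
      · simp
    · refine (Finset.sum_eq_zero fun i hi => ?_).symm
      have := hmono i (Finset.mem_range.1 hi).le
      rw [if_neg (by rintro ⟨h', _⟩; linarith), mul_zero]
  rw [hA, hB, ← Finset.sum_sub_distrib]
  refine Finset.sum_congr rfl fun i hi => ?_
  rw [← mul_sub]
  congr 1
  have := hlt i (Finset.mem_range.1 hi)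
  clear haff hlt hmono hmono' hA hB
  grind

/-! ### Points and directions of the realization -/

namespace CombGraph

variable {G : CombGraph}

/-- The normal form of a point: a vertex, or an edge with an interior coordinate. -/
def normalForm : G.Space → G.V ⊕ (G.E × ℝ) :=
  Quot.lift
    (fun p => match p.1 with
      | Sum.inl v => Sum.inl v
      | Sum.inr q => if q.2 ≤ 0 then Sum.inl (G.src q.1)
          else if G.len q.1 ≤ q.2 then Sum.inl (G.tgt q.1) else Sum.inr q)
    (by
      rintro _ _ (e | e)
      · simp
      · simp [G.len_pos e])

theorem normalForm_vertexPt (v : G.V) : normalForm (G.vertexPt v) = Sum.inl v := rfl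

theorem clamp_of_mem {e : G.E} {t : ℝ} (h0 : 0 ≤ t) (hL : t ≤ G.len e) : G.clamp e t = t := by
  simp [clamp, h0, hL]

theorem normalForm_edgePt {e : G.E} {t : ℝ} (h0 : 0 ≤ t) (hL : t ≤ G.len e) :
    normalForm (G.edgePt e t) = if t = 0 then Sum.inl (G.src e)
      else if t = G.len e then Sum.inl (G.tgt e) else Sum.inr (e, t) := by
  change (if G.clamp e t ≤ 0 then Sum.inl (G.src e)
          else if G.len e ≤ G.clamp e t then Sum.inl (G.tgt e) else Sum.inr (e, G.clamp e t)) = _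
  rw [clamp_of_mem h0 hL]
  simp only [h0.ge_iff_eq', hL.ge_iff_eq]

theorem edgePt_zero (e : G.E) : G.edgePt e 0 = G.vertexPt (G.src e) := by
  have h : G.clamp e 0 = 0 := clamp_of_mem le_rfl (G.len_pos e).le
  simp only [edgePt, h]
  exact (Quot.sound (Glue.srcGlue e)).symm

theorem edgePt_len (e : G.E) : G.edgePt e (G.len e) = G.vertexPt (G.tgt e) := by
  have h : G.clamp e (G.len e) = G.len e := clamp_of_mem (G.len_pos e).le le_rfl
  simp only [edgePt, h]
  exact (Quot.sound (Glue.tgtGlue e)).symm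

theorem vertexPt_injective : Function.Injective G.vertexPt := fun _ _ h =>
  Sum.inl_injective (congrArg normalForm h)

theorem edgePt_eq_vertexPt_iff {e : G.E} {t : ℝ} {v : G.V} (h0 : 0 ≤ t) (hL : t ≤ G.len e) :
    G.edgePt e t = G.vertexPt v ↔ (t = 0 ∧ G.src e = v) ∨ (t = G.len e ∧ G.tgt e = v) := by
  constructor
  · intro h
    have := congrArg normalForm h
    rw [normalForm_edgePt h0 hL, normalForm_vertexPt] at this
    grind
  · rintro (⟨rfl, rfl⟩ | ⟨rfl, rfl⟩)
    · exact edgePt_zero e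
    · exact edgePt_len e

theorem edgePt_eq_interior_iff {e e' : G.E} {t t' : ℝ} (h0 : 0 ≤ t) (hL : t ≤ G.len e)
    (h0' : 0 < t') (hL' : t' < G.len e') :
    G.edgePt e t = G.edgePt e' t' ↔ e = e' ∧ t = t' := by
  constructor
  · intro h
    have := congrArg normalForm h
    rw [normalForm_edgePt h0 hL, normalForm_edgePt h0'.le hL'.le, if_neg h0'.ne',
      if_neg hL'.ne] at this
    grind
  · rintro ⟨rfl, rfl⟩; rfl

theorem vertex_or_interior (x : G.Space) :
    (∃ v, x = G.vertexPt v) ∨ ∃ e t, 0 < t ∧ t < G.len e ∧ x = G.edgePt e t := by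
  induction x using Quot.ind with
  | mk p =>
    obtain ⟨v | ⟨e, t⟩, hp⟩ := p
    · exact Or.inl ⟨v, rfl⟩
    · have hp : 0 ≤ t ∧ t ≤ G.len e := hp
      have hx : (Quot.mk _ ⟨Sum.inr (e, t), hp⟩ : G.Space) = G.edgePt e t := by
        simp only [edgePt, clamp_of_mem hp.1 hp.2]
      rcases hp.1.eq_or_lt with rfl | h0
      · exact Or.inl ⟨_, hx.trans (edgePt_zero e)⟩
      rcases hp.2.eq_or_lt with rfl | hL
      · exact Or.inl ⟨_, hx.trans (edgePt_len e)⟩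
      · exact Or.inr ⟨e, t, h0, hL, hx⟩

theorem isDir_true_iff {x : G.Space} {e : G.E} :
    G.IsDir x (e, true) ↔ ∃ t, 0 ≤ t ∧ t < G.len e ∧ x = G.edgePt e t := by
  simp [IsDir]

theorem isDir_false_iff {x : G.Space} {e : G.E} :
    G.IsDir x (e, false) ↔ ∃ t, 0 < t ∧ t ≤ G.len e ∧ x = G.edgePt e t := by
  simp [IsDir]

theorem edgePt_injOn_Ico (e : G.E) : Set.InjOn (G.edgePt e) (Set.Ico 0 (G.len e)) := by
  rintro s ⟨hs0, hs⟩ t ⟨ht0, ht⟩ h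
  have := congrArg normalForm h
  rw [normalForm_edgePt hs0 hs.le, normalForm_edgePt ht0 ht.le] at this
  grind

theorem edgePt_injOn_Ioc (e : G.E) : Set.InjOn (G.edgePt e) (Set.Ioc 0 (G.len e)) := by
  rintro s ⟨hs0, hs⟩ t ⟨ht0, ht⟩ h
  have := congrArg normalForm h
  rw [normalForm_edgePt hs0.le hs, normalForm_edgePt ht0.le ht] at this
  grind

theorem dirCoord_true {e : G.E} {t : ℝ} (h0 : 0 ≤ t) (hL : t < G.len e) :
    G.dirCoord (G.edgePt e t) (e, true) = t := by
  have h : ∃ s, 0 ≤ s ∧ s < G.len e ∧ G.edgePt e t = G.edgePt e s := ⟨t, h0, hL, rfl⟩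
  have hs := h.choose_spec
  simp only [dirCoord, if_true, dif_pos h]
  exact (edgePt_injOn_Ico e ⟨h0, hL⟩ ⟨hs.1, hs.2.1⟩ hs.2.2).symm

theorem dirCoord_false {e : G.E} {t : ℝ} (h0 : 0 < t) (hL : t ≤ G.len e) :
    G.dirCoord (G.edgePt e t) (e, false) = t := by
  have h : ∃ s, 0 < s ∧ s ≤ G.len e ∧ G.edgePt e t = G.edgePt e s := ⟨t, h0, hL, rfl⟩
  have hs := h.choose_spec
  simp only [dirCoord, Bool.false_eq_true, if_false, dif_pos h]
  exact (edgePt_injOn_Ioc e ⟨h0, hL⟩ ⟨hs.1, hs.2.1⟩ hs.2.2).symm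

theorem dirPt_true {e : G.E} {t : ℝ} (h0 : 0 ≤ t) (hL : t < G.len e) (u : ℝ) :
    G.dirPt (G.edgePt e t) (e, true) u = G.edgePt e (t + u) := by
  simp [dirPt, dirCoord_true h0 hL]

theorem dirPt_false {e : G.E} {t : ℝ} (h0 : 0 < t) (hL : t ≤ G.len e) (u : ℝ) :
    G.dirPt (G.edgePt e t) (e, false) u = G.edgePt e (t - u) := by
  simp [dirPt, dirCoord_false h0 hL, sub_eq_add_neg]

theorem isDir_vertexPt_true {v : G.V} {e : G.E} :
    G.IsDir (G.vertexPt v) (e, true) ↔ G.src e = v := by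
  rw [isDir_true_iff]
  constructor
  · rintro ⟨t, h0, hL, h⟩
    rcases (edgePt_eq_vertexPt_iff h0 hL.le).1 h.symm with h | h
    · exact h.2
    · exact absurd h.1 hL.ne
  · rintro rfl
    exact ⟨0, le_rfl, G.len_pos e, (edgePt_zero e).symm⟩

theorem isDir_vertexPt_false {v : G.V} {e : G.E} :
    G.IsDir (G.vertexPt v) (e, false) ↔ G.tgt e = v := by
  rw [isDir_false_iff]
  constructor
  · rintro ⟨t, h0, hL, h⟩
    rcases (edgePt_eq_vertexPt_iff h0.le hL).1 h.symm with h | h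
    · exact absurd h.1 h0.ne'
    · exact h.2
  · rintro rfl
    exact ⟨G.len e, G.len_pos e, le_rfl, (edgePt_len e).symm⟩

theorem isDir_interior {e e' : G.E} {t : ℝ} (h0 : 0 < t) (hL : t < G.len e) (b : Bool) :
    G.IsDir (G.edgePt e t) (e', b) ↔ e' = e := by
  constructor
  · intro h
    cases b
    · obtain ⟨s, hs0, hs, h⟩ := isDir_false_iff.1 h
      exact ((edgePt_eq_interior_iff hs0.le hs h0 hL).1 h.symm).1
    · obtain ⟨s, hs0, hs, h⟩ := isDir_true_iff.1 h
      exact ((edgePt_eq_interior_iff hs0 hs.le h0 hL).1 h.symm).1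
  · rintro rfl
    cases b
    · exact isDir_false_iff.2 ⟨t, h0, hL.le, rfl⟩
    · exact isDir_true_iff.2 ⟨t, h0.le, hL, rfl⟩

/-! ### Outgoing slopes and orders -/

/-- The function `F` is affine of slope `s` near `x` in the outgoing direction `d`. -/
def HasOutSlope (F : G.Space → ℝ) (x : G.Space) (d : G.E × Bool) (s : ℝ) : Prop :=
  ∃ ε > (0 : ℝ), ∀ u, 0 ≤ u → u ≤ ε → F (G.dirPt x d u) = F x + s * u

theorem hasOutSlope_true_iff {F : G.Space → ℝ} {e : G.E} {t s : ℝ} (h0 : 0 ≤ t)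
    (hL : t < G.len e) :
    HasOutSlope F (G.edgePt e t) (e, true) s ↔ HasRightSlope (fun u => F (G.edgePt e u)) t s := by
  simp only [HasOutSlope, HasRightSlope, dirPt_true h0 hL]

theorem hasOutSlope_false_iff {F : G.Space → ℝ} {e : G.E} {t s : ℝ} (h0 : 0 < t)
    (hL : t ≤ G.len e) :
    HasOutSlope F (G.edgePt e t) (e, false) s ↔
      HasRightSlope (fun u => F (G.edgePt e (-u))) (-t) s := by
  simp only [HasOutSlope, HasRightSlope, dirPt_false h0 hL, neg_add, neg_neg, sub_eq_add_neg]

theorem exists_hasOutSlope (f : RatFn G) {x : G.Space} {d : G.E × Bool} (h : G.IsDir x d) :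
    ∃ k : ℤ, HasOutSlope f.toFun x d k := by
  obtain ⟨e, b⟩ := d
  cases b
  · obtain ⟨t, h0, hL, rfl⟩ := isDir_false_iff.1 h
    simp only [hasOutSlope_false_iff h0 hL]
    exact (f.piecewise e).exists_left h0 hL
  · obtain ⟨t, h0, hL, rfl⟩ := isDir_true_iff.1 h
    simp only [hasOutSlope_true_iff h0 hL]
    exact (f.piecewise e).exists_right h0 hL

theorem HasOutSlope.rightSlope_eq {f : RatFn G} {e : G.E} {t s : ℝ} (h0 : 0 ≤ t)
    (hL : t < G.len e) (h : HasOutSlope f.toFun (G.edgePt e t) (e, true) s) :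
    G.rightSlope f e t = s :=
  ((hasOutSlope_true_iff h0 hL).1 h).derivWithin_eq

theorem HasOutSlope.leftSlope_eq {f : RatFn G} {e : G.E} {t s : ℝ} (h0 : 0 < t)
    (hL : t ≤ G.len e) (h : HasOutSlope f.toFun (G.edgePt e t) (e, false) s) :
    G.leftSlope f e t = -s :=
  HasRightSlope.derivWithin_reflect (F := fun u => f.toFun (G.edgePt e u))
    ((hasOutSlope_false_iff h0 hL).1 h)

theorem ordAt_vertexPt (f : RatFn G) (v : G.V) :
    G.ordAt f (G.vertexPt v) = ∑ e : G.E, ((if G.src e = v then G.rightSlope f e 0 else 0)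
        + (if G.tgt e = v then -(G.leftSlope f e (G.len e)) else 0)) := by
  have h : ∃ w, G.vertexPt v = G.vertexPt w := ⟨v, rfl⟩
  have hv : h.choose = v := (vertexPt_injective h.choose_spec).symm
  rw [ordAt, dif_pos h, hv]

theorem ordAt_interior (f : RatFn G) {e : G.E} {t : ℝ} (h0 : 0 < t) (hL : t < G.len e) :
    G.ordAt f (G.edgePt e t) = G.rightSlope f e t - G.leftSlope f e t := by
  have h : ¬ ∃ v, G.edgePt e t = G.vertexPt v := by
    rintro ⟨v, hv⟩
    rcases (edgePt_eq_vertexPt_iff h0.le hL.le).1 hv with h | h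
    · exact h0.ne' h.1
    · exact hL.ne h.1
  have h2 : ∃ p : G.E × ℝ, 0 < p.2 ∧ p.2 < G.len p.1 ∧ G.edgePt e t = G.edgePt p.1 p.2 :=
    ⟨(e, t), h0, hL, rfl⟩
  have hs := h2.choose_spec
  obtain ⟨h3, h4⟩ := (edgePt_eq_interior_iff h0.le hL.le hs.1 hs.2.1).1 hs.2.2
  rw [ordAt, dif_neg h, dif_pos h2, ← h3, ← h4]

theorem ordAt_eq_sum {f : RatFn G} {x : G.Space} {s : G.E × Bool → ℝ}
    (h : ∀ d, G.IsDir x d → HasOutSlope f.toFun x d (s d)) :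
    G.ordAt f x = ∑ d ∈ G.dirSet x, s d := by
  rw [dirSet, Finset.sum_filter, Fintype.sum_prod_type]
  simp only [Fintype.sum_bool]
  rcases vertex_or_interior x with ⟨v, rfl⟩ | ⟨e, t, h0, hL, rfl⟩
  · rw [ordAt_vertexPt]
    refine Finset.sum_congr rfl fun e _ => ?_
    simp only [isDir_vertexPt_true, isDir_vertexPt_false]
    congr 1
    · split_ifs with hv
      · have := h _ (isDir_vertexPt_true.2 hv)
        rw [← hv, ← edgePt_zero] at this
        exact this.rightSlope_eq le_rfl (G.len_pos e)
      · rfl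
    · split_ifs with hv
      · have := h _ (isDir_vertexPt_false.2 hv)
        rw [← hv, ← edgePt_len] at this
        rw [this.leftSlope_eq (G.len_pos e) le_rfl, neg_neg]
      · rfl
  · rw [ordAt_interior f h0 hL]
    simp only [isDir_interior h0 hL]
    rw [Finset.sum_eq_single e (fun e' _ hne => by simp [hne]) (by simp), if_pos rfl, if_pos rfl,
      (h _ ((isDir_interior h0 hL true).2 rfl)).rightSlope_eq h0.le hL,
      (h _ ((isDir_interior h0 hL false).2 rfl)).leftSlope_eq h0 hL.le, sub_neg_eq_add]

/-! ### Degrees -/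

theorem degDiv_add (D D' : Div G) : G.degDiv (D + D') = G.degDiv D + G.degDiv D' :=
  Finsupp.sum_add_index' (fun _ => rfl) fun _ _ _ => rfl

theorem degDiv_sub (D D' : Div G) : G.degDiv (D - D') = G.degDiv D - G.degDiv D' :=
  Finsupp.sum_sub_index fun _ _ _ => rfl

theorem degDiv_single (x : G.Space) (n : ℤ) : G.degDiv (Finsupp.single x n) = n :=
  Finsupp.sum_single_index rfl

theorem degDiv_sum {ι : Type*} (s : Finset ι) (D : ι → Div G) :
    G.degDiv (∑ i ∈ s, D i) = ∑ i ∈ s, G.degDiv (D i) :=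
  map_sum (AddMonoidHom.mk' G.degDiv degDiv_add) D s

theorem degDiv_nonneg {D : Div G} (h : G.Effective D) : 0 ≤ G.degDiv D :=
  Finset.sum_nonneg fun x _ => h x

/-- A principal divisor has degree zero. -/
theorem IsPrincipal.degDiv_eq_zero {P : Div G} {f : RatFn G} (h : G.IsPrincipal P f) :
    G.degDiv P = 0 := by
  choose n t m b ht0 htn hlt haff using f.piecewise
  have hmem : ∀ e i, i ≤ n e → 0 ≤ t e i ∧ t e i ≤ G.len e := by
    intro e
    have hmono : ∀ j, ∀ i, i ≤ j → j ≤ n e → t e i ≤ t e j := by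
      intro j i hij
      induction j, hij using Nat.le_induction with
      | base => intro; exact le_rfl
      | succ j _ ih => intro hj; exact (ih (by omega)).trans (hlt e j (by omega)).le
    intro i hi
    exact ⟨(ht0 e).ge.trans (hmono i 0 (Nat.zero_le _) hi), (hmono _ i hi le_rfl).trans (htn e).le⟩
  set Q : Div G := ∑ e : G.E, ∑ i ∈ Finset.range (n e),
    (Finsupp.single (G.edgePt e (t e i)) (m e i)
      - Finsupp.single (G.edgePt e (t e (i + 1))) (m e i)) with hQ
  have hdeg : G.degDiv Q = 0 := by
    simp [hQ, degDiv_sum, degDiv_sub, degDiv_single]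
  have hval : ∀ x, (Q x : ℝ) = ∑ e : G.E, ∑ i ∈ Finset.range (n e),
      (m e i : ℝ) * ((if G.edgePt e (t e i) = x then 1 else 0)
        - if G.edgePt e (t e (i + 1)) = x then 1 else 0) := by
    intro x
    simp only [hQ, Finsupp.finsetSum_apply, Finsupp.sub_apply, Finsupp.single_apply]
    push_cast
    simp only [mul_sub, mul_ite, mul_one, mul_zero]
  suffices hPQ : P = Q by rw [hPQ, hdeg]
  ext x
  have hjump := fun e s => sum_pieces_eq_slope_sub (s := s) (ht0 e) (htn e) (hlt e) (haff e)
  rw [← Int.cast_inj (α := ℝ), h x, hval]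
  rcases vertex_or_interior x with ⟨v, rfl⟩ | ⟨e, s, h0, hL, rfl⟩
  · rw [ordAt_vertexPt]
    refine Finset.sum_congr rfl fun e _ => ?_
    have hpos := G.len_pos e
    have hj0 := hjump e 0 le_rfl hpos.le
    have hjL := hjump e (G.len e) hpos.le le_rfl
    simp only [hpos, lt_irrefl, if_true, if_false, sub_zero, zero_sub] at hj0 hjL
    have hind : ∀ i, i ≤ n e → (if G.edgePt e (t e i) = G.vertexPt v then (1 : ℝ) else 0)
        = (if G.src e = v then 1 else 0) * (if t e i = 0 then 1 else 0)
          + (if G.tgt e = v then 1 else 0) * (if t e i = G.len e then 1 else 0) := by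
      intro i hi
      simp only [edgePt_eq_vertexPt_iff (hmem e i hi).1 (hmem e i hi).2]
      grind
    rw [rightSlope, leftSlope, ← hj0, ← hjL]
    calc _ = ∑ i ∈ Finset.range (n e),
          ((if G.src e = v then 1 else 0) * ((m e i : ℝ) * ((if t e i = 0 then 1 else 0)
            - if t e (i + 1) = 0 then 1 else 0))
          + (if G.tgt e = v then 1 else 0) * ((m e i : ℝ) * ((if t e i = G.len e then 1 else 0)
            - if t e (i + 1) = G.len e then 1 else 0))) := by
          rw [Finset.sum_add_distrib, ← Finset.mul_sum, ← Finset.mul_sum]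
          simp only [ite_mul, one_mul, zero_mul]
      _ = _ := by
          refine Finset.sum_congr rfl fun i hi => ?_
          have hi := Finset.mem_range.1 hi
          rw [hind i hi.le, hind (i + 1) hi]
          ring
  · rw [ordAt_interior f h0 hL, Finset.sum_eq_single e]
    · have := hjump e s h0.le hL.le
      rw [if_pos hL, if_pos h0] at this
      rw [rightSlope, leftSlope, ← this]
      refine Finset.sum_congr rfl fun i hi => ?_
      have hi := Finset.mem_range.1 hi
      simp only [edgePt_eq_interior_iff (hmem e i hi.le).1 (hmem e i hi.le).2 h0 hL,
        edgePt_eq_interior_iff (hmem e (i + 1) hi).1 (hmem e (i + 1) hi).2 h0 hL, true_and]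
    · intro e' _ hne
      refine Finset.sum_eq_zero fun i hi => ?_
      have hi := Finset.mem_range.1 hi
      simp [edgePt_eq_interior_iff (hmem e' i hi.le).1 (hmem e' i hi.le).2 h0 hL,
        edgePt_eq_interior_iff (hmem e' (i + 1) hi).1 (hmem e' (i + 1) hi).2 h0 hL, hne]
    · simp

end CombGraph

/-! ### Pullback along a cover -/

namespace TropCover

variable {G D : CombGraph} (π : TropCover G D)

theorem hasOutSlope_comp {F : D.Space → ℝ} {x : G.Space} {d : G.E × Bool} (hd : G.IsDir x d)
    {s : ℝ} (h : CombGraph.HasOutSlope F (π.toFun x) (π.dirMap x d) s) :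
    CombGraph.HasOutSlope (fun z => F (π.toFun z)) x d (π.slope x d * s) := by
  obtain ⟨ε, hε, h⟩ := h
  obtain ⟨δ, hδ, hδ'⟩ := π.locAffine x d hd
  have hpos : (0 : ℝ) < π.slope x d + 1 := by positivity
  refine ⟨min δ (ε / (π.slope x d + 1)), by positivity, fun u hu hu' => ?_⟩
  have h1 : u * (π.slope x d + 1) ≤ ε := (le_div_iff₀ hpos).1 (hu'.trans (min_le_right _ _))
  simp only [hδ' u hu (hu'.trans (min_le_left _ _))]
  rw [h _ (by positivity) (by linarith)]
  ring

/-- The pullback of a rational function along a cover. -/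
def pullbackFn (f : RatFn D) : RatFn G where
  toFun x := f.toFun (π.toFun x)
  continuous := f.continuous.comp π.continuous
  piecewise e := by
    have key : ∀ x d, G.IsDir x d →
        ∃ k : ℤ, CombGraph.HasOutSlope (fun z => f.toFun (π.toFun z)) x d k := by
      intro x d hd
      obtain ⟨k, hk⟩ := CombGraph.exists_hasOutSlope f (π.dirMap_isDir x d hd)
      refine ⟨π.slope x d * k, ?_⟩
      push_cast
      exact π.hasOutSlope_comp hd hk
    refine PWIntAffine.of_germs (G.len_pos e).le (fun t h0 hL => ?_) fun t h0 hL => ?_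
    · obtain ⟨k, hk⟩ := key _ _ (CombGraph.isDir_true_iff.2 ⟨t, h0, hL, rfl⟩)
      exact ⟨k, (CombGraph.hasOutSlope_true_iff h0 hL).1 hk⟩
    · obtain ⟨k, hk⟩ := key _ _ (CombGraph.isDir_false_iff.2 ⟨t, h0, hL, rfl⟩)
      exact ⟨k, (CombGraph.hasOutSlope_false_iff h0 hL).1 hk⟩

theorem ordAt_pullbackFn (f : RatFn D) (x : G.Space) :
    G.ordAt (π.pullbackFn f) x = π.localDeg x * D.ordAt f (π.toFun x) := by
  choose! k hk using fun d (hd : D.IsDir (π.toFun x) d) => CombGraph.exists_hasOutSlope f hd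
  have hmaps : ∀ d ∈ G.dirSet x, π.dirMap x d ∈ D.dirSet (π.toFun x) := fun d hd =>
    Finset.mem_filter.2 ⟨Finset.mem_univ _, π.dirMap_isDir x d (Finset.mem_filter.1 hd).2⟩
  rw [CombGraph.ordAt_eq_sum (s := fun d => k d) hk,
    CombGraph.ordAt_eq_sum (s := fun d => π.slope x d * k (π.dirMap x d)) fun d hd =>
      π.hasOutSlope_comp hd (hk _ (π.dirMap_isDir x d hd)),
    ← Finset.sum_fiberwise_of_maps_to hmaps, Finset.mul_sum]
  refine Finset.sum_congr rfl fun d' hd' => ?_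
  rw [π.localDeg_spec x d' (Finset.mem_filter.1 hd').2, Nat.cast_sum, Finset.sum_mul]
  refine Finset.sum_congr rfl fun d hd => ?_
  rw [(Finset.mem_filter.1 hd).2]

theorem fiberDiv_apply (y : D.Space) (x : G.Space) :
    π.fiberDiv y x = if π.toFun x = y then (π.localDeg x : ℤ) else 0 := by
  simp [fiberDiv, fiber, Finsupp.finsetSum_apply, Finsupp.single_apply]

theorem pullback_apply (A : D.Div) (x : G.Space) :
    π.pullback A x = π.localDeg x * A (π.toFun x) := by
  simp only [pullback, Finsupp.sum, Finsupp.finsetSum_apply, Finsupp.smul_apply, fiberDiv_apply,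
    smul_eq_mul, mul_ite, mul_zero]
  rw [Finset.sum_ite_eq]
  split_ifs with h
  · ring
  · simp [Finsupp.notMem_support_iff.1 h]

theorem slope_pos {x : G.Space} {d : G.E × Bool} (hd : G.IsDir x d) : 0 < π.slope x d := by
  by_contra h0
  have h0 : π.slope x d = 0 := by omega
  obtain ⟨ε, hε, h⟩ := π.locAffine x d hd
  simp only [h0, Nat.cast_zero, zero_mul] at h
  have hinj : ∃ δ > (0 : ℝ), Set.InjOn (G.dirPt x d) (Set.Icc 0 δ) := by
    obtain ⟨e, b⟩ := d
    cases b
    · obtain ⟨t, ht0, htL, rfl⟩ := CombGraph.isDir_false_iff.1 hd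
      refine ⟨t / 2, by linarith, fun u hu v hv huv => ?_⟩
      rw [CombGraph.dirPt_false ht0 htL, CombGraph.dirPt_false ht0 htL] at huv
      have := CombGraph.edgePt_injOn_Ioc e ⟨by linarith [hu.2], by linarith [hu.1]⟩
        ⟨by linarith [hv.2], by linarith [hv.1]⟩ huv
      linarith
    · obtain ⟨t, ht0, htL, rfl⟩ := CombGraph.isDir_true_iff.1 hd
      refine ⟨(G.len e - t) / 2, by linarith, fun u hu v hv huv => ?_⟩
      rw [CombGraph.dirPt_true ht0 htL, CombGraph.dirPt_true ht0 htL] at huv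
      have := CombGraph.edgePt_injOn_Ico e ⟨by linarith [hu.1], by linarith [hu.2]⟩
        ⟨by linarith [hv.1], by linarith [hv.2]⟩ huv
      linarith
  obtain ⟨δ, hδ, hinj⟩ := hinj
  have hinf : (Set.Icc 0 (min ε δ)).Infinite := Set.Icc_infinite (lt_min hε hδ)
  refine hinf (Set.Finite.of_finite_image
    ((π.finiteFibers (D.dirPt (π.toFun x) (π.dirMap x d) 0)).subset ?_)
    (hinj.mono (Set.Icc_subset_Icc_right (min_le_right _ _))))
  rintro _ ⟨u, hu, rfl⟩
  exact h u hu.1 (hu.2.trans (min_le_left _ _))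

theorem localDeg_pos (x : G.Space) : 0 < π.localDeg x := by
  by_contra h0
  have h0 : π.localDeg x = 0 := by omega
  have hrh := π.rh_nonneg x
  rw [h0, Nat.cast_zero, zero_mul, sub_zero] at hrh
  obtain ⟨d, hd⟩ := Finset.card_pos.1 (show 0 < (G.dirSet x).card by
    change 0 < G.valence x
    omega)
  have hdir := (Finset.mem_filter.1 hd).2
  have := π.localDeg_spec x _ (π.dirMap_isDir x d hdir)
  rw [h0, eq_comm, Finset.sum_eq_zero_iff] at this
  exact (π.slope_pos hdir).ne' (this d (Finset.mem_filter.2 ⟨hd, rfl⟩))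

theorem le_pushforward_apply {E : G.Div} (hE : G.Effective E) (x : G.Space) :
    E x ≤ π.pushforward E (π.toFun x) := by
  rw [pushforward, Finsupp.mapDomain, Finsupp.sum_apply]
  by_cases hx : x ∈ E.support
  · refine le_trans ?_ (Finset.single_le_sum (fun z _ => ?_) hx)
    · simp
    · simp only [Finsupp.single_apply]
      split_ifs
      exacts [hE z, le_rfl]
  · rw [Finsupp.notMem_support_iff.1 hx]
    refine Finset.sum_nonneg fun z _ => ?_
    simp only [Finsupp.single_apply]
    split_ifs
    exacts [hE z, le_rfl]

theorem pushforward_effective {E : G.Div} (hE : G.Effective E) :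
    D.Effective (π.pushforward E) := by
  intro y
  obtain ⟨x, rfl⟩ := π.surjective y
  exact (hE x).trans (π.le_pushforward_apply hE x)

theorem degDiv_pushforward (E : G.Div) : D.degDiv (π.pushforward E) = G.degDiv E :=
  Finsupp.sum_mapDomain_index (fun _ => rfl) fun _ _ _ => rfl

end TropCover

/-- the pullback of a divisor along a tropical admissible cover has
rank at least the rank of the divisor. -/
theorem rank_pullback_ge (Γ Δ : CombGraph)
    (hΓc : CompactSpace Γ.Space) (hΓ : ConnectedSpace Γ.Space)
    (hΔc : CompactSpace Δ.Space) (hΔ : ConnectedSpace Δ.Space)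
    (π : TropCover Γ Δ) (A : Δ.Div) :
    Δ.Rk A ≤ Γ.Rk (π.pullback A) := by
  refine csSup_le_csSup ⟨max (-1) (Γ.degDiv (π.pullback A)), fun k hk => ?_⟩
    ⟨-1, fun E hE hdeg => ?_⟩ fun k hk E hE hdeg => ?_
  · obtain ⟨x⟩ := hΓ.toNonempty
    rcases lt_or_ge k 0 with h0 | h0
    · omega
    · obtain ⟨E', hE', f, hf⟩ := hk (Finsupp.single x k)
        (fun z => by rw [Finsupp.single_apply]; split_ifs; exacts [h0, le_rfl])
        (CombGraph.degDiv_single x k)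
      have := hf.degDiv_eq_zero
      rw [CombGraph.degDiv_sub, CombGraph.degDiv_sub, CombGraph.degDiv_single] at this
      have := CombGraph.degDiv_nonneg hE'
      omega
  · have := CombGraph.degDiv_nonneg hE
    omega
  · obtain ⟨E', hE', f, hf⟩ := hk (π.pushforward E) (π.pushforward_effective hE)
      ((π.degDiv_pushforward E).trans hdeg)
    refine ⟨π.pullback E' + (π.pullback (π.pushforward E) - E), fun x => ?_, π.pullbackFn f,
      fun x => ?_⟩
    · have h1 := π.localDeg_pos x
      have h2 := π.le_pushforward_apply hE x
      have h3 := π.pushforward_effective hE (π.toFun x)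
      have h4 := hE' (π.toFun x)
      simp only [Finsupp.add_apply, Finsupp.sub_apply, TropCover.pullback_apply]
      have h5 : (1 : ℤ) ≤ π.localDeg x := by exact_mod_cast h1
      nlinarith [mul_nonneg (zero_le_one.trans h5) h4]
    · rw [π.ordAt_pullbackFn, ← hf]
      simp only [Finsupp.add_apply, Finsupp.sub_apply, TropCover.pullback_apply]
      push_cast
      ring
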